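/- There exists a constant C ∈ ℕ (independent of r, P, T, S, m and the cell) such that the following holds: if S is an optimal solution, k = |P|, and m ≥ 1 is a natural number, then for every axis-aligned closed square of side length 2mr (a cell), the number of sensors of S lying in that square is at most C·(m² + k). -/

import Mathlib

/-- The set of points covered by a finite set `S` of sensors with sensing
radius `r` includes every target: for each `t ∈ T` there is `s ∈ S` with
`dist s t ≤ r`. -/
def Covers (r : ℝ) (T : Set (EuclideanSpace ℝ (Fin 2)))
    (S : Finset (EuclideanSpace ℝ (Fin 2))) : Prop :=
  ∀ t ∈ T, ∃ s ∈ S, dist s t ≤ r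

/-- The total moving cost of a sensor set `S`: each sensor moves from its
nearest station in `P`. -/
noncomputable def cost (P S : Finset (EuclideanSpace ℝ (Fin 2))) : ℝ :=
  ∑ s ∈ S, Metric.infDist s (P : Set (EuclideanSpace ℝ (Fin 2)))

/-- `S` is an optimal solution: it covers `T` and has minimum cost among all
finite sensor sets covering `T`. -/
def Optimal (r : ℝ) (P : Finset (EuclideanSpace ℝ (Fin 2)))
    (T : Set (EuclideanSpace ℝ (Fin 2)))
    (S : Finset (EuclideanSpace ℝ (Fin 2))) : Prop :=
  Covers r T S ∧
    ∀ S' : Finset (EuclideanSpace ℝ (Fin 2)), Covers r T S' → cost P S ≤ cost P S'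

/-- The plane `ℝ²` with its Euclidean distance. -/
local notation "ℰ" => EuclideanSpace ℝ (Fin 2)

theorem dist_le_iff_coord {r : ℝ} (hr : 0 ≤ r) (s t : ℰ) :
    dist s t ≤ r ↔ (s 0 - t 0) ^ 2 + (s 1 - t 1) ^ 2 ≤ r ^ 2 := by
  rw [EuclideanSpace.dist_eq, Real.sqrt_le_left hr, Fin.sum_univ_two, Real.dist_eq, Real.dist_eq,
    sq_abs, sq_abs]

theorem dist_sq_coord (s t : ℰ) : dist s t ^ 2 = (s 0 - t 0) ^ 2 + (s 1 - t 1) ^ 2 := by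
  rw [EuclideanSpace.dist_eq, Real.sq_sqrt (by positivity), Fin.sum_univ_two, Real.dist_eq,
    Real.dist_eq, sq_abs, sq_abs]

theorem cost_insert_le (P B : Finset ℰ) (q : ℰ) :
    cost P (insert q B) ≤ Metric.infDist q (P : Set ℰ) + cost P B := by
  classical
  by_cases h : q ∈ B
  · rw [Finset.insert_eq_of_mem h]
    linarith [Metric.infDist_nonneg (x := q) (s := (P : Set ℰ))]
  · unfold cost
    rw [Finset.sum_insert h]

theorem cost_singleton (P : Finset ℰ) (q : ℰ) :
    cost P {q} = Metric.infDist q (P : Set ℰ) := by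
  simp [cost]

/-- Replacing part of an optimal solution by sensors that keep every target covered
does not lower the cost. -/
theorem Optimal.cost_le_of_exchange {r : ℝ} {P : Finset ℰ} {T : Set ℰ} {S : Finset ℰ}
    (hS : Optimal r P T S) {A B : Finset ℰ} (hA : A ⊆ S)
    (h : ∀ t, ∀ s ∈ A, dist s t ≤ r → ∃ b, (b ∈ B ∨ (b ∈ S ∧ b ∉ A)) ∧ dist b t ≤ r) :
    cost P A ≤ cost P B := by
  classical
  have hcov : Covers r T (S \ A ∪ B) := by
    intro t ht
    obtain ⟨s, hs, hst⟩ := hS.1 t ht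
    by_cases hsA : s ∈ A
    · obtain ⟨b, hb, hbt⟩ := h t s hsA hst
      refine ⟨b, ?_, hbt⟩
      simp only [Finset.mem_union, Finset.mem_sdiff]
      tauto
    · exact ⟨s, by simp [hs, hsA], hst⟩
  have h1 := hS.2 _ hcov
  have h2 : cost P (S \ A ∪ B) ≤ cost P (S \ A) + cost P B := by
    unfold cost
    rw [← Finset.sum_union_inter]
    have : 0 ≤ ∑ s ∈ (S \ A) ∩ B, Metric.infDist s (P : Set ℰ) :=
      Finset.sum_nonneg fun _ _ => Metric.infDist_nonneg
    linarith
  have h3 : cost P (S \ A) + cost P A = cost P S := Finset.sum_sdiff hA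
  linarith

/-- If the unit vectors `x`, `y` are close and `β` is much larger than `α`, a point `w` of the disc
of radius `r` around `α • x` outside the discs around `0` and `β • y` is close to
one of the two points at distance `2 / 5 * α` from `0` orthogonally to `x`. -/
theorem covered_by_orthogonal {r α β x₀ x₁ y₀ y₁ w₀ w₁ : ℝ} (hα : 0 < α)
    (hαβ : 20 * α ≤ β) (hβ : β ≤ r / 10) (hx : x₀ ^ 2 + x₁ ^ 2 = 1)
    (hxy : (x₀ - y₀) ^ 2 + (x₁ - y₁) ^ 2 ≤ 1 / 100) (hy : y₀ ^ 2 + y₁ ^ 2 = 1)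
    (h0 : r ^ 2 < w₀ ^ 2 + w₁ ^ 2)
    (ha : (α * x₀ - w₀) ^ 2 + (α * x₁ - w₁) ^ 2 ≤ r ^ 2)
    (hb : r ^ 2 < (β * y₀ - w₀) ^ 2 + (β * y₁ - w₁) ^ 2) :
    (-(2 / 5 * α * x₁) - w₀) ^ 2 + (2 / 5 * α * x₀ - w₁) ^ 2 ≤ r ^ 2 ∨
      (2 / 5 * α * x₁ - w₀) ^ 2 + (-(2 / 5 * α * x₀) - w₁) ^ 2 ≤ r ^ 2 := by
  obtain ⟨ω, hω0, hω⟩ : ∃ ω : ℝ, 0 ≤ ω ∧ ω ^ 2 = w₀ ^ 2 + w₁ ^ 2 :=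
    ⟨√(w₀ ^ 2 + w₁ ^ 2), Real.sqrt_nonneg _, Real.sq_sqrt (by positivity)⟩
  have hrω : r < ω := lt_of_pow_lt_pow_left₀ 2 hω0 (by rw [hω]; exact h0)
  have hβ0 : 0 < β := by linarith
  obtain ⟨p, hp⟩ : ∃ p, p = w₀ * x₀ + w₁ * x₁ := ⟨_, rfl⟩
  obtain ⟨q, hq⟩ : ∃ q, q = w₁ * x₀ - w₀ * x₁ := ⟨_, rfl⟩
  obtain ⟨z, hz⟩ : ∃ z, z = w₀ * y₀ + w₁ * y₁ := ⟨_, rfl⟩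
  have hpq : p ^ 2 + q ^ 2 = ω ^ 2 := by
    rw [hp, hq, hω]
    linear_combination (w₀ ^ 2 + w₁ ^ 2) * hx
  have hpz : p - z ≤ ω / 10 := by
    apply le_of_sq_le_sq _ (by positivity)
    have : (p - z) ^ 2 ≤ (w₀ ^ 2 + w₁ ^ 2) * ((x₀ - y₀) ^ 2 + (x₁ - y₁) ^ 2) := by
      rw [hp, hz]
      nlinarith [sq_nonneg (w₀ * (x₁ - y₁) - w₁ * (x₀ - y₀))]
    rw [← hω] at this
    nlinarith [mul_le_mul_of_nonneg_left hxy (sq_nonneg ω)]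
  have ha' : ω ^ 2 - r ^ 2 ≤ 2 * α * p - α ^ 2 := by
    rw [hω, hp]
    linear_combination ha - α ^ 2 * hx
  have hb' : 2 * β * z - β ^ 2 < ω ^ 2 - r ^ 2 := by
    rw [hω, hz]
    linear_combination hb + β ^ 2 * hy
  have hH : 0 < ω ^ 2 - r ^ 2 := by rw [hω]; linarith
  have hpω : p ≤ ω := le_of_sq_le_sq (by linarith [sq_nonneg q]) hω0
  have hp0 : 0 < p := by
    by_contra hneg
    linarith [mul_nonneg hα.le (sub_nonneg.2 (not_lt.1 hneg)), sq_nonneg α]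
  have hzω : z ≤ ω / 10 := by
    by_contra hneg
    have h1 : β * (ω / 10) ≤ β * z := mul_le_mul_of_nonneg_left (not_le.1 hneg).le hβ0.le
    have h2 : α * p ≤ α * ω := mul_le_mul_of_nonneg_left hpω hα.le
    have h3 : 20 * α * ω ≤ β * ω := mul_le_mul_of_nonneg_right hαβ hω0
    have h4 : β * β ≤ β * (ω / 10) := mul_le_mul_of_nonneg_left (by linarith) hβ0.le
    linarith [sq_nonneg α]
  have hp5 : p ≤ ω / 5 := by linarith
  have hq9 : (9 / 10 * ω) ^ 2 ≤ q ^ 2 := by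
    linarith [pow_le_pow_left₀ hp0.le hp5 2, sq_nonneg ω]
  have hαω : α * p ≤ α * (ω / 5) := mul_le_mul_of_nonneg_left hp5 hα.le
  rcases le_total 0 q with hq0 | hq0
  · left
    have hq' : 9 / 10 * ω ≤ q := le_of_sq_le_sq hq9 hq0
    have hαq : α * (9 / 10 * ω) ≤ α * q := mul_le_mul_of_nonneg_left hq' hα.le
    have : (-(2 / 5 * α * x₁) - w₀) ^ 2 + (2 / 5 * α * x₀ - w₁) ^ 2
        = 4 / 25 * α ^ 2 + ω ^ 2 - 4 / 5 * (α * q) := by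
      rw [hω, hq]
      linear_combination 4 / 25 * α ^ 2 * hx
    rw [this]
    linarith [sq_nonneg α, mul_nonneg hα.le hω0]
  · right
    have hq' : 9 / 10 * ω ≤ -q := le_of_sq_le_sq (by rwa [neg_sq]) (by linarith)
    have hαq : α * (9 / 10 * ω) ≤ α * -q := mul_le_mul_of_nonneg_left hq' hα.le
    have : (2 / 5 * α * x₁ - w₀) ^ 2 + (-(2 / 5 * α * x₀) - w₁) ^ 2
        = 4 / 25 * α ^ 2 + ω ^ 2 - 4 / 5 * (α * -q) := by
      rw [hω, hq]
      linear_combination 4 / 25 * α ^ 2 * hx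
    rw [this]
    linarith [sq_nonneg α, mul_nonneg hα.le hω0]

/-- A disc of radius `r` whose centre is within `δ` of `0` is covered by the discs of radius `r`
around `0` and the four points at distance `2 * δ` along the axes. -/
theorem covered_by_cross {r δ a₀ a₁ w₀ w₁ : ℝ} (hr : 0 < r) (hδ : 0 < δ) (hδr : δ ≤ r / 10)
    (ha : a₀ ^ 2 + a₁ ^ 2 ≤ δ ^ 2) (h0 : r ^ 2 < w₀ ^ 2 + w₁ ^ 2)
    (haw : (a₀ - w₀) ^ 2 + (a₁ - w₁) ^ 2 ≤ r ^ 2) :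
    ((2 * δ - w₀) ^ 2 + w₁ ^ 2 ≤ r ^ 2 ∨ (-(2 * δ) - w₀) ^ 2 + w₁ ^ 2 ≤ r ^ 2) ∨
      (w₀ ^ 2 + (2 * δ - w₁) ^ 2 ≤ r ^ 2 ∨ w₀ ^ 2 + (-(2 * δ) - w₁) ^ 2 ≤ r ^ 2) := by
  have hin : (a₀ * (w₀ - a₀) + a₁ * (w₁ - a₁)) ≤ δ * r := by
    apply le_of_sq_le_sq _ (by positivity)
    have : (a₀ * (w₀ - a₀) + a₁ * (w₁ - a₁)) ^ 2
        ≤ (a₀ ^ 2 + a₁ ^ 2) * ((a₀ - w₀) ^ 2 + (a₁ - w₁) ^ 2) := by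
      nlinarith [sq_nonneg (a₀ * (w₁ - a₁) - a₁ * (w₀ - a₀))]
    calc _ ≤ _ := this
      _ ≤ δ ^ 2 * r ^ 2 := by gcongr
      _ = _ := by ring
  have hw : w₀ ^ 2 + w₁ ^ 2 ≤ r ^ 2 + 2 * (δ * r) + δ ^ 2 := by nlinarith
  have hδδ : δ * δ ≤ δ * (r / 10) := mul_le_mul_of_nonneg_left hδr hδ.le
  have key : ∀ v : ℝ, 7 / 10 * r ≤ v → 4 * δ ^ 2 - 4 * (δ * v) + (w₀ ^ 2 + w₁ ^ 2) ≤ r ^ 2 := by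
    intro v hv
    have := mul_le_mul_of_nonneg_left hv hδ.le
    nlinarith
  have hbig : (7 / 10 * r) ^ 2 ≤ w₀ ^ 2 ∨ (7 / 10 * r) ^ 2 ≤ w₁ ^ 2 := by
    by_contra! hneg
    nlinarith [hneg.1, hneg.2, pow_pos hr 2]
  have habs : ∀ v : ℝ, (7 / 10 * r) ^ 2 ≤ v ^ 2 → 7 / 10 * r ≤ v ∨ 7 / 10 * r ≤ -v := fun v hv =>
    le_abs.1 (le_of_sq_le_sq (by rwa [sq_abs]) (abs_nonneg v))
  rcases hbig with hbig | hbig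
  · left
    rcases habs _ hbig with h | h
    · left
      linarith [key _ h]
    · right
      linarith [key _ h]
  · right
    rcases habs _ hbig with h | h
    · left
      linarith [key _ h]
    · right
      linarith [key _ h]

theorem infDist_le_of_coord {P : Finset ℰ} {p : ℰ} (hp : p ∈ P) {c : ℝ} (hc : 0 ≤ c) (q : ℰ)
    (h : (q 0 - p 0) ^ 2 + (q 1 - p 1) ^ 2 ≤ c ^ 2) : Metric.infDist q (P : Set ℰ) ≤ c :=
  (Metric.infDist_le_dist_of_mem (by exact_mod_cast hp)).trans ((dist_le_iff_coord hc q p).2 h)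

/-- In an optimal solution, a sensor close to its station cannot be accompanied by a much more
distant sensor in almost the same direction from that station. -/
theorem Optimal.dist_lt_twenty_mul_dist {r : ℝ} (hr : 0 < r) {P : Finset ℰ} {T : Set ℰ}
    {S : Finset ℰ} (hS : Optimal r P T S) {p a b : ℰ} (hp : p ∈ P) (haS : a ∈ S) (hbS : b ∈ S)
    (ha : Metric.infDist a (P : Set ℰ) = dist a p) (ha0 : 0 < dist a p)
    (hbr : dist b p ≤ r / 10)
    (hab : ((a 0 - p 0) / dist a p - (b 0 - p 0) / dist b p) ^ 2
      + ((a 1 - p 1) / dist a p - (b 1 - p 1) / dist b p) ^ 2 ≤ 1 / 100) :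
    dist b p < 20 * dist a p := by
  by_contra! hlt
  have hα := dist_sq_coord a p
  have hβ := dist_sq_coord b p
  set α := dist a p
  set β := dist b p
  have hβ0 : 0 < β := by linarith
  obtain ⟨x₀, hx₀⟩ : ∃ x, x = (a 0 - p 0) / α := ⟨_, rfl⟩
  obtain ⟨x₁, hx₁⟩ : ∃ x, x = (a 1 - p 1) / α := ⟨_, rfl⟩
  obtain ⟨y₀, hy₀⟩ : ∃ x, x = (b 0 - p 0) / β := ⟨_, rfl⟩
  obtain ⟨y₁, hy₁⟩ : ∃ x, x = (b 1 - p 1) / β := ⟨_, rfl⟩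
  rw [← hx₀, ← hx₁, ← hy₀, ← hy₁] at hab
  have hax₀ : a 0 = p 0 + α * x₀ := by rw [hx₀]; field_simp; ring
  have hax₁ : a 1 = p 1 + α * x₁ := by rw [hx₁]; field_simp; ring
  have hby₀ : b 0 = p 0 + β * y₀ := by rw [hy₀]; field_simp; ring
  have hby₁ : b 1 = p 1 + β * y₁ := by rw [hy₁]; field_simp; ring
  have hx : x₀ ^ 2 + x₁ ^ 2 = 1 := by
    rw [hx₀, hx₁, div_pow, div_pow, ← add_div, ← hα, div_self (by positivity)]
  have hy : y₀ ^ 2 + y₁ ^ 2 = 1 := by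
    rw [hy₀, hy₁, div_pow, div_pow, ← add_div, ← hβ, div_self (by positivity)]
  have hne : b ≠ a := by
    rintro rfl
    change 20 * β ≤ β at hlt
    linarith
  let u : ℰ := !₂[p 0 - 2 / 5 * α * x₁, p 1 + 2 / 5 * α * x₀]
  let v : ℰ := !₂[p 0 + 2 / 5 * α * x₁, p 1 - 2 / 5 * α * x₀]
  have hu : Metric.infDist u (P : Set ℰ) ≤ 2 / 5 * α := by
    apply infDist_le_of_coord hp (by positivity)
    simp only [u, Matrix.cons_val_zero, Matrix.cons_val_one]
    linear_combination 4 / 25 * α ^ 2 * hx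
  have hv : Metric.infDist v (P : Set ℰ) ≤ 2 / 5 * α := by
    apply infDist_le_of_coord hp (by positivity)
    simp only [v, Matrix.cons_val_zero, Matrix.cons_val_one]
    linear_combination 4 / 25 * α ^ 2 * hx
  have hp0 : Metric.infDist p (P : Set ℰ) = 0 := Metric.infDist_zero_of_mem (by exact_mod_cast hp)
  have hcost := hS.cost_le_of_exchange (A := {a}) (B := {p, u, v}) (by simpa using haS) ?_
  · have h1 := cost_insert_le P {u, v} p
    have h2 := cost_insert_le P {v} u
    rw [cost_singleton] at h2 hcost
    linarith
  · intro t s hs hst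
    rw [Finset.mem_singleton] at hs
    subst hs
    by_cases hpt : dist p t ≤ r
    · exact ⟨p, by simp, hpt⟩
    by_cases hbt : dist b t ≤ r
    · exact ⟨b, by simp [hbS, hne], hbt⟩
    rw [dist_le_iff_coord hr.le, not_le] at hpt hbt
    rw [dist_le_iff_coord hr.le] at hst
    rcases covered_by_orthogonal (w₀ := t 0 - p 0) (w₁ := t 1 - p 1) ha0 hlt hbr hx hab hy
      (by linarith) (by rw [hax₀, hax₁] at hst; linarith) (by rw [hby₀, hby₁] at hbt; linarith)
      with h | h
    · refine ⟨u, by simp, (dist_le_iff_coord hr.le _ _).2 ?_⟩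
      simp only [u, Matrix.cons_val_zero, Matrix.cons_val_one]
      linarith
    · refine ⟨v, by simp, (dist_le_iff_coord hr.le _ _).2 ?_⟩
      simp only [v, Matrix.cons_val_zero, Matrix.cons_val_one]
      linarith

/-- Sensors of an optimal solution close to a station have total distance to it at most
`8` times any bound `δ` on their distances. -/
theorem Optimal.cost_le_of_dist_le {r δ : ℝ} (hr : 0 < r) {P : Finset ℰ} {T : Set ℰ}
    {S : Finset ℰ} (hS : Optimal r P T S) {p : ℰ} (hp : p ∈ P) (hδ : 0 < δ) (hδr : δ ≤ r / 10)
    {A : Finset ℰ} (hA : A ⊆ S) (hAδ : ∀ a ∈ A, dist a p ≤ δ) : cost P A ≤ 8 * δ := by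
  let u : ℰ := !₂[p 0 + 2 * δ, p 1]
  let u' : ℰ := !₂[p 0 - 2 * δ, p 1]
  let v : ℰ := !₂[p 0, p 1 + 2 * δ]
  let v' : ℰ := !₂[p 0, p 1 - 2 * δ]
  have hu : Metric.infDist u (P : Set ℰ) ≤ 2 * δ := by
    apply infDist_le_of_coord hp (by positivity)
    simp only [u, Matrix.cons_val_zero, Matrix.cons_val_one]
    linarith
  have hu' : Metric.infDist u' (P : Set ℰ) ≤ 2 * δ := by
    apply infDist_le_of_coord hp (by positivity)
    simp only [u', Matrix.cons_val_zero, Matrix.cons_val_one]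
    linarith
  have hv : Metric.infDist v (P : Set ℰ) ≤ 2 * δ := by
    apply infDist_le_of_coord hp (by positivity)
    simp only [v, Matrix.cons_val_zero, Matrix.cons_val_one]
    linarith
  have hv' : Metric.infDist v' (P : Set ℰ) ≤ 2 * δ := by
    apply infDist_le_of_coord hp (by positivity)
    simp only [v', Matrix.cons_val_zero, Matrix.cons_val_one]
    linarith
  have hp0 : Metric.infDist p (P : Set ℰ) = 0 := Metric.infDist_zero_of_mem (by exact_mod_cast hp)
  have hcost := hS.cost_le_of_exchange (A := A) (B := {p, u, u', v, v'}) hA ?_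
  · have h1 := cost_insert_le P {u, u', v, v'} p
    have h2 := cost_insert_le P {u', v, v'} u
    have h3 := cost_insert_le P {v, v'} u'
    have h4 := cost_insert_le P {v'} v
    rw [cost_singleton] at h4
    linarith
  · intro t s hs hst
    by_cases hpt : dist p t ≤ r
    · exact ⟨p, by simp, hpt⟩
    have hsp := (dist_le_iff_coord hδ.le _ _).1 (hAδ s hs)
    rw [dist_le_iff_coord hr.le, not_le] at hpt
    rw [dist_le_iff_coord hr.le] at hst
    rcases covered_by_cross (w₀ := t 0 - p 0) (w₁ := t 1 - p 1) hr hδ hδr hsp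
      (by linarith) (by linarith) with (h | h) | (h | h)
    · refine ⟨u, by simp, (dist_le_iff_coord hr.le _ _).2 ?_⟩
      simp only [u, Matrix.cons_val_zero, Matrix.cons_val_one]
      linarith
    · refine ⟨u', by simp, (dist_le_iff_coord hr.le _ _).2 ?_⟩
      simp only [u', Matrix.cons_val_zero, Matrix.cons_val_one]
      linarith
    · refine ⟨v, by simp, (dist_le_iff_coord hr.le _ _).2 ?_⟩
      simp only [v, Matrix.cons_val_zero, Matrix.cons_val_one]
      linarith
    · refine ⟨v', by simp, (dist_le_iff_coord hr.le _ _).2 ?_⟩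
      simp only [v', Matrix.cons_val_zero, Matrix.cons_val_one]
      linarith

theorem sq_sub_le_of_floor_eq {x y : ℝ} (h : ⌊20 * x⌋ = ⌊20 * y⌋) : (x - y) ^ 2 ≤ 1 / 400 := by
  have h1 := abs_lt.1 (Int.abs_sub_lt_one_of_floor_eq_floor h)
  nlinarith [h1.1, h1.2]

/-- Near a station, an optimal solution has boundedly many sensors whose directions from the
station are close to each other. -/
theorem Optimal.card_le_of_same_direction {r : ℝ} (hr : 0 < r) {P : Finset ℰ} {T : Set ℰ}
    {S : Finset ℰ} (hS : Optimal r P T S) {p : ℰ} (hp : p ∈ P) {A : Finset ℰ} (hA : A ⊆ S)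
    (hAp : ∀ a ∈ A, Metric.infDist a (P : Set ℰ) = dist a p ∧ 0 < dist a p ∧ dist a p ≤ r / 10)
    (hdir : ∀ a ∈ A, ∀ b ∈ A, ((a 0 - p 0) / dist a p - (b 0 - p 0) / dist b p) ^ 2
      + ((a 1 - p 1) / dist a p - (b 1 - p 1) / dist b p) ^ 2 ≤ 1 / 100) :
    A.card ≤ 160 := by
  rcases A.eq_empty_or_nonempty with rfl | hne
  · simp
  obtain ⟨b, hb, hmax⟩ := A.exists_max_image (fun a => dist a p) hne
  obtain ⟨-, hb0, hbr⟩ := hAp b hb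
  have hle := hS.cost_le_of_dist_le hr hp hb0 hbr hA hmax
  have hge : (A.card : ℝ) * (dist b p / 20) ≤ cost P A := by
    rw [← nsmul_eq_mul]
    refine Finset.card_nsmul_le_sum _ _ _ fun a ha => ?_
    obtain ⟨ha1, ha0, -⟩ := hAp a ha
    have := hS.dist_lt_twenty_mul_dist hr hp (hA ha) (hA hb) ha1 ha0 hbr (hdir a ha b hb)
    rw [ha1]
    linarith
  have : (A.card : ℝ) * dist b p ≤ 160 * dist b p := by linarith
  exact_mod_cast le_of_mul_le_mul_right this hb0

theorem floor_twenty_mul_mem_Icc {x : ℝ} (h : x ^ 2 ≤ 1) :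
    ⌊20 * x⌋ ∈ Finset.Icc (-20 : ℤ) 20 := by
  obtain ⟨h1, h2⟩ := abs_le.1 ((sq_le_one_iff_abs_le_one x).1 h)
  rw [Finset.mem_Icc]
  constructor
  · rw [Int.le_floor]; push_cast; linarith
  · rw [← Int.lt_add_one_iff, Int.floor_lt]; push_cast; linarith

/-- An optimal solution has boundedly many sensors close to, but not at, a given station. -/
theorem Optimal.card_near_station_le {r : ℝ} (hr : 0 < r) {P : Finset ℰ} {T : Set ℰ}
    {S : Finset ℰ} (hS : Optimal r P T S) {p : ℰ} (hp : p ∈ P) {A : Finset ℰ} (hA : A ⊆ S)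
    (hAp : ∀ a ∈ A, Metric.infDist a (P : Set ℰ) = dist a p ∧ 0 < dist a p ∧
      dist a p ≤ r / 10) :
    A.card ≤ 160 * 1681 := by
  classical
  let f : ℰ → ℤ × ℤ := fun a =>
    (⌊20 * ((a 0 - p 0) / dist a p)⌋, ⌊20 * ((a 1 - p 1) / dist a p)⌋)
  have hf : ∀ a ∈ A, f a ∈ Finset.Icc (-20 : ℤ) 20 ×ˢ Finset.Icc (-20 : ℤ) 20 := by
    intro a ha
    obtain ⟨-, ha0, -⟩ := hAp a ha
    have hα := dist_sq_coord a p
    refine Finset.mem_product.2 ⟨floor_twenty_mul_mem_Icc ?_, floor_twenty_mul_mem_Icc ?_⟩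
    · rw [div_pow, div_le_one (by positivity), hα]
      linarith [sq_nonneg (a 1 - p 1)]
    · rw [div_pow, div_le_one (by positivity), hα]
      linarith [sq_nonneg (a 0 - p 0)]
  refine (Finset.card_le_mul_card_image_of_maps_to hf 160 fun c _ => ?_).trans_eq (by simp)
  refine hS.card_le_of_same_direction hr hp ((Finset.filter_subset _ _).trans hA)
    (fun a ha => hAp a (Finset.mem_filter.1 ha).1) fun a ha b hb => ?_
  have hab : f a = f b := (Finset.mem_filter.1 ha).2.trans (Finset.mem_filter.1 hb).2.symm
  have h0 := sq_sub_le_of_floor_eq (congrArg Prod.fst hab)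
  have h1 := sq_sub_le_of_floor_eq (congrArg Prod.snd hab)
  linarith

/-- An optimal solution has at most `O(k)` sensors within distance `r / 10` of the stations. -/
theorem Optimal.card_near_le {r : ℝ} (hr : 0 < r) {P : Finset ℰ} (hP : P.Nonempty) {T : Set ℰ}
    {S : Finset ℰ} (hS : Optimal r P T S) {A : Finset ℰ} (hA : A ⊆ S)
    (hAr : ∀ a ∈ A, Metric.infDist a (P : Set ℰ) ≤ r / 10) :
    A.card ≤ (160 * 1681 + 1) * P.card := by
  classical
  have hnear : ∀ a : ℰ, ∃ p ∈ P, Metric.infDist a (P : Set ℰ) = dist a p := fun a => by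
    obtain ⟨p, hp, h⟩ := P.finite_toSet.isCompact.exists_infDist_eq_dist (by simpa using hP) a
    exact ⟨p, by simpa using hp, h⟩
  choose g hgP hg using hnear
  refine Finset.card_le_mul_card_image_of_maps_to (fun a _ => hgP a) _ fun p hp => ?_
  have hsub : A.filter (fun a => g a = p) ⊆
      insert p ((A.filter fun a => g a = p).filter fun a => a ≠ p) := by
    intro a ha
    by_cases h : a = p
    · simp [h]
    · exact Finset.mem_insert_of_mem (Finset.mem_filter.2 ⟨ha, h⟩)
  refine (Finset.card_le_card hsub).trans ((Finset.card_insert_le _ _).trans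
    (Nat.add_le_add_right ?_ 1))
  refine hS.card_near_station_le hr hp
    (((Finset.filter_subset _ _).trans (Finset.filter_subset _ _)).trans hA) fun a ha => ?_
  obtain ⟨ha', hap⟩ := Finset.mem_filter.1 ha
  obtain ⟨haA, rfl⟩ := Finset.mem_filter.1 ha'
  exact ⟨hg a, dist_pos.2 hap, hg a ▸ hAr a haA⟩

/-- Far from the stations, an optimal solution has boundedly many sensors in a square of
side length `r`. -/
theorem Optimal.card_far_square_le {r : ℝ} (hr : 0 < r) {P : Finset ℰ}
    {T : Set ℰ} {S : Finset ℰ} (hS : Optimal r P T S) {A : Finset ℰ} (hA : A ⊆ S)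
    (hAr : ∀ a ∈ A, r / 10 < Metric.infDist a (P : Set ℰ)) (x y : ℝ)
    (hx : ∀ a ∈ A, x ≤ a 0 ∧ a 0 ≤ x + r) (hy : ∀ a ∈ A, y ≤ a 1 ∧ a 1 ≤ y + r) :
    A.card ≤ 279 := by
  classical
  rcases A.eq_empty_or_nonempty with rfl | hne
  · simp
  obtain ⟨b, hb, hmin⟩ := A.exists_min_image (fun a => Metric.infDist a (P : Set ℰ)) hne
  have hbr := hAr b hb
  set D := Metric.infDist b (P : Set ℰ)
  let I : Finset ℝ := {-(r / 2), r / 2, 3 * r / 2}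
  have hI : ∀ i ∈ I, -(r / 2) ≤ i ∧ i ≤ 3 * r / 2 := by
    intro i hi
    simp only [I, Finset.mem_insert, Finset.mem_singleton] at hi
    rcases hi with rfl | rfl | rfl <;> constructor <;> linarith
  have hcover : ∀ z s t : ℝ, z ≤ s → s ≤ z + r → (s - t) ^ 2 ≤ r ^ 2 →
      ∃ i ∈ I, (z + i - t) ^ 2 ≤ (r / 2) ^ 2 := by
    intro z s t h1 h2 h3
    obtain ⟨h4, h5⟩ := abs_le_of_sq_le_sq' h3 hr.le
    rcases le_total t z with h | h
    · exact ⟨-(r / 2), by simp [I], sq_le_sq' (by linarith) (by linarith)⟩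
    rcases le_total t (z + r) with h' | h'
    · exact ⟨r / 2, by simp [I], sq_le_sq' (by linarith) (by linarith)⟩
    · exact ⟨3 * r / 2, by simp [I], sq_le_sq' (by linarith) (by linarith)⟩
  let c : ℝ × ℝ → ℰ := fun i => !₂[x + i.1, y + i.2]
  let B : Finset ℰ := (I ×ˢ I).image c
  have hBcard : B.card ≤ 9 := by
    refine Finset.card_image_le.trans ?_
    rw [Finset.card_product]
    have : I.card ≤ 3 := Finset.card_le_three
    nlinarith
  have hcost : cost P A ≤ cost P B := by
    refine hS.cost_le_of_exchange hA fun t s hs hst => ?_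
    rw [dist_le_iff_coord hr.le] at hst
    obtain ⟨i, hi, hi'⟩ := hcover x (s 0) (t 0) (hx s hs).1 (hx s hs).2
      (by linarith [sq_nonneg (s 1 - t 1)])
    obtain ⟨j, hj, hj'⟩ := hcover y (s 1) (t 1) (hy s hs).1 (hy s hs).2
      (by linarith [sq_nonneg (s 0 - t 0)])
    refine ⟨c (i, j), Or.inl (Finset.mem_image_of_mem c (Finset.mk_mem_product hi hj)),
      (dist_le_iff_coord hr.le _ _).2 ?_⟩
    simp only [c, Matrix.cons_val_zero, Matrix.cons_val_one]
    linarith [sq_nonneg r]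
  have hB : ∀ q ∈ B, Metric.infDist q (P : Set ℰ) ≤ 31 * D := by
    intro q hq
    obtain ⟨⟨i, j⟩, hij, rfl⟩ := Finset.mem_image.1 hq
    obtain ⟨hi, hj⟩ := Finset.mem_product.1 hij
    have hi' := hI i hi
    have hj' := hI j hj
    have hd : dist (c (i, j)) b ≤ 3 * r := by
      rw [dist_le_iff_coord (by positivity)]
      simp only [c, Matrix.cons_val_zero, Matrix.cons_val_one]
      have h1 : (x + i - b 0) ^ 2 ≤ (2 * r) ^ 2 :=
        sq_le_sq' (by linarith [(hx b hb).2]) (by linarith [(hx b hb).1])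
      have h2 : (y + j - b 1) ^ 2 ≤ (2 * r) ^ 2 :=
        sq_le_sq' (by linarith [(hy b hb).2]) (by linarith [(hy b hb).1])
      linarith [sq_nonneg r]
    have := Metric.infDist_le_infDist_add_dist (s := (P : Set ℰ)) (x := c (i, j)) (y := b)
    linarith
  have hle : cost P B ≤ B.card * (31 * D) := by
    rw [← nsmul_eq_mul]
    exact Finset.sum_le_card_nsmul _ _ _ hB
  have hge : A.card * D ≤ cost P A := by
    rw [← nsmul_eq_mul]
    exact Finset.card_nsmul_le_sum _ _ _ hmin
  have hD : 0 < D := by linarith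
  have hB9 : (B.card : ℝ) * (31 * D) ≤ 9 * (31 * D) := by
    gcongr
    exact_mod_cast hBcard
  have : (A.card : ℝ) * D ≤ 279 * D := by linarith
  exact_mod_cast le_of_mul_le_mul_right this hD

theorem floor_div_mem_range {r x z : ℝ} (hr : 0 < r) (m : ℕ)
    (hz : z ∈ Set.Icc x (x + 2 * m * r)) : ⌊(z - x) / r⌋₊ ∈ Finset.range (2 * m + 1) := by
  rw [Finset.mem_range, Nat.floor_lt (div_nonneg (by linarith [hz.1]) hr.le), div_lt_iff₀ hr]
  push_cast
  linarith [hz.2]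

theorem mem_Icc_of_floor_div_eq {r x z : ℝ} (hr : 0 < r) {n : ℕ} (hxz : x ≤ z)
    (h : ⌊(z - x) / r⌋₊ = n) : x + n * r ≤ z ∧ z ≤ x + n * r + r := by
  rw [Nat.floor_eq_iff (div_nonneg (by linarith) hr.le), le_div_iff₀ hr, div_lt_iff₀ hr] at h
  constructor <;> linarith

/-- Far from the stations, an optimal solution has `O(m ^ 2)` sensors in a square of
side length `2 * m * r`. -/
theorem Optimal.card_far_le {r : ℝ} (hr : 0 < r) {P : Finset ℰ} {T : Set ℰ} {S : Finset ℰ}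
    (hS : Optimal r P T S) {A : Finset ℰ} (hA : A ⊆ S)
    (hAr : ∀ a ∈ A, r / 10 < Metric.infDist a (P : Set ℰ)) (m : ℕ) (x y : ℝ)
    (hx : ∀ a ∈ A, a 0 ∈ Set.Icc x (x + 2 * m * r))
    (hy : ∀ a ∈ A, a 1 ∈ Set.Icc y (y + 2 * m * r)) :
    A.card ≤ 279 * ((2 * m + 1) * (2 * m + 1)) := by
  classical
  let f : ℰ → ℕ × ℕ := fun a => (⌊(a 0 - x) / r⌋₊, ⌊(a 1 - y) / r⌋₊)
  have hf : ∀ a ∈ A, f a ∈ Finset.range (2 * m + 1) ×ˢ Finset.range (2 * m + 1) := fun a ha =>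
    Finset.mk_mem_product (floor_div_mem_range hr m (hx a ha)) (floor_div_mem_range hr m (hy a ha))
  refine (Finset.card_le_mul_card_image_of_maps_to hf 279 fun c _ => ?_).trans_eq (by simp)
  refine hS.card_far_square_le hr ((Finset.filter_subset _ _).trans hA)
    (fun a ha => hAr a (Finset.mem_filter.1 ha).1) (x + c.1 * r) (y + c.2 * r)
    (fun a ha => ?_) fun a ha => ?_
  · obtain ⟨haA, hac⟩ := Finset.mem_filter.1 ha
    exact mem_Icc_of_floor_div_eq hr (hx a haA).1 (congrArg Prod.fst hac)
  · obtain ⟨haA, hac⟩ := Finset.mem_filter.1 ha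
    exact mem_Icc_of_floor_div_eq hr (hy a haA).1 (congrArg Prod.snd hac)

theorem stmt_11 :
    ∃ C : ℕ, ∀ (r : ℝ), 0 < r →
      ∀ (P : Finset (EuclideanSpace ℝ (Fin 2))), P.Nonempty →
      ∀ (T : Set (EuclideanSpace ℝ (Fin 2)))
        (S : Finset (EuclideanSpace ℝ (Fin 2))), Optimal r P T S →
      ∀ m : ℕ, 1 ≤ m →
      ∀ x₀ y₀ : ℝ,
        {s : EuclideanSpace ℝ (Fin 2) | s ∈ S ∧
            s 0 ∈ Set.Icc x₀ (x₀ + 2 * m * r) ∧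
            s 1 ∈ Set.Icc y₀ (y₀ + 2 * m * r)}.ncard ≤ C * (m ^ 2 + P.card) := by
  classical
  refine ⟨160 * 1681 + 1, fun r hr P hP T S hS m hm x₀ y₀ => ?_⟩
  let Q : Finset (EuclideanSpace ℝ (Fin 2)) := S.filter fun s =>
    s 0 ∈ Set.Icc x₀ (x₀ + 2 * m * r) ∧ s 1 ∈ Set.Icc y₀ (y₀ + 2 * m * r)
  have hQ : {s : EuclideanSpace ℝ (Fin 2) | s ∈ S ∧ s 0 ∈ Set.Icc x₀ (x₀ + 2 * m * r) ∧
      s 1 ∈ Set.Icc y₀ (y₀ + 2 * m * r)} = (Q : Set (EuclideanSpace ℝ (Fin 2))) := by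
    ext s
    simp [Q]
  rw [hQ, Set.ncard_coe_finset]
  have hQS : Q ⊆ S := Finset.filter_subset _ _
  have hsplit := Q.card_filter_add_card_filter_not
    (fun s => Metric.infDist s (P : Set (EuclideanSpace ℝ (Fin 2))) ≤ r / 10)
  have hnear := hS.card_near_le hr hP ((Finset.filter_subset _ _).trans hQS)
    fun a ha => (Finset.mem_filter.1 ha).2
  have hfar := hS.card_far_le hr ((Finset.filter_subset _ _).trans hQS)
    (fun a ha => not_le.1 (Finset.mem_filter.1 ha).2) m x₀ y₀
    (fun a ha => (Finset.mem_filter.1 (Finset.mem_filter.1 ha).1).2.1)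
    fun a ha => (Finset.mem_filter.1 (Finset.mem_filter.1 ha).1).2.2
  nlinarith
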